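/- The series ∑_{n=1}^∞ 1/ℓ(n) converges, where ℓ(n) = lcm(n, z(n)). -/

import Mathlib

open scoped BigOperators

/-- `fibZ m` is the rank of appearance of `m`: the least positive `n` with `m ∣ F_n`. -/
noncomputable def fibZ (m : ℕ) : ℕ := sInf {n : ℕ | 0 < n ∧ m ∣ Nat.fib n}

/-- `fibL m = lcm(m, z(m))`. -/
noncomputable def fibL (m : ℕ) : ℕ := Nat.lcm m (fibZ m)

/-- `countIn S x` is the number of elements of `S` in `[1, x]`. -/
noncomputable def countIn (S : Set ℕ) (x : ℝ) : ℕ :=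
  (S ∩ {n : ℕ | 1 ≤ n ∧ (n : ℝ) ≤ x}).ncard

/-- `S` has asymptotic density `a`. -/
def HasDensity (S : Set ℕ) (a : ℝ) : Prop :=
  Filter.Tendsto (fun x : ℝ => (countIn S x : ℝ) / x) Filter.atTop (nhds a)

/-- `fibA k` is the set of positive integers `n` with `gcd(n, F_n) = k`. -/
def fibA (k : ℕ) : Set ℕ := {n : ℕ | 0 < n ∧ Nat.gcd n (Nat.fib n) = k}

/-- A prime `p ≠ 5` divides `F_{p² - 1}`. -/
theorem Nat.Prime.dvd_fib_sq_sub_one {p : ℕ} (hp : p.Prime) (h5 : p ≠ 5) :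
    p ∣ Nat.fib (p ^ 2 - 1) := by
  have : Fact p.Prime := ⟨hp⟩
  let K := AlgebraicClosure (ZMod p)
  have : CharP K p := charP_of_injective_algebraMap (algebraMap (ZMod p) K).injective p
  obtain ⟨φ, hφ⟩ : ∃ φ : K, φ ^ 2 = φ + 1 := by
    have hdeg : (Polynomial.X ^ 2 - Polynomial.X - 1 : Polynomial K).degree = 2 := by
      compute_degree!
    obtain ⟨x, hx⟩ := IsAlgClosed.exists_root (Polynomial.X ^ 2 - Polynomial.X - 1 : Polynomial K)
      (by rw [hdeg]; norm_num)
    refine ⟨x, ?_⟩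
    simp only [Polynomial.IsRoot.def, Polynomial.eval_sub, Polynomial.eval_pow, Polynomial.eval_X,
      Polynomial.eval_one] at hx
    linear_combination hx
  have root_cases : ∀ x : K, x ^ 2 = x + 1 → x = φ ∨ x = 1 - φ := by
    intro x hx
    have : (x - φ) * (x - (1 - φ)) = 0 := by linear_combination hx - hφ
    rcases _root_.mul_eq_zero.mp this with h | h
    · exact Or.inl (sub_eq_zero.mp h)
    · exact Or.inr (sub_eq_zero.mp h)
  have frob_root : ∀ x : K, x ^ 2 = x + 1 → (x ^ p) ^ 2 = x ^ p + 1 := by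
    intro x hx
    rw [← pow_mul, mul_comm, pow_mul, hx, add_pow_char, one_pow]
  have hfrob : (φ ^ p) ^ p = φ := by
    rcases root_cases _ (frob_root φ hφ) with h | h
    · rw [h, h]
    · rw [h, sub_pow_char, one_pow, h]; ring
  have hψ : (1 - φ) ^ 2 = (1 - φ) + 1 := by linear_combination hφ
  have hfrob' : ((1 - φ) ^ p) ^ p = 1 - φ := by
    rw [sub_pow_char, sub_pow_char, one_pow, one_pow, hfrob]
  have pow_eq_one : ∀ x : K, x ^ 2 = x + 1 → (x ^ p) ^ p = x → x ^ (p ^ 2 - 1) = 1 := by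
    intro x hx hxp
    have hx0 : x ≠ 0 := by rintro rfl; simp at hx
    have hpos : 1 ≤ p ^ 2 := Nat.one_le_pow _ _ hp.pos
    apply mul_right_cancel₀ hx0
    rw [← pow_succ, Nat.sub_add_cancel hpos, one_mul, sq, pow_mul, hxp]
  have binet : ∀ n : ℕ, (Nat.fib n : K) * (φ - (1 - φ)) = φ ^ n - (1 - φ) ^ n ∧
      (Nat.fib (n + 1) : K) * (φ - (1 - φ)) = φ ^ (n + 1) - (1 - φ) ^ (n + 1) := by
    intro n
    induction n with
    | zero => simp
    | succ n ih =>
      refine ⟨ih.2, ?_⟩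
      rw [Nat.fib_add_two]
      push_cast
      linear_combination ih.1 + ih.2 - φ ^ n * hφ + (1 - φ) ^ n * hψ
  have h := (binet (p ^ 2 - 1)).1
  rw [pow_eq_one φ hφ hfrob, pow_eq_one _ hψ hfrob', sub_self] at h
  have hdisc : φ - (1 - φ) ≠ 0 := by
    intro h0
    have : ((5 : ℕ) : K) = 0 := by
      push_cast
      linear_combination (φ - (1 - φ)) * h0 - 4 * hφ
    rw [CharP.cast_eq_zero_iff K p] at this
    exact h5 ((Nat.prime_dvd_prime_iff_eq hp Nat.prime_five).mp this)
  exact (CharP.cast_eq_zero_iff K p _).mp ((_root_.mul_eq_zero.mp h).resolve_right hdisc)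

theorem fibZ_pos_and_dvd {m k : ℕ} (hk : 0 < k) (h : m ∣ Nat.fib k) :
    0 < fibZ m ∧ m ∣ Nat.fib (fibZ m) :=
  Nat.sInf_mem (s := {n : ℕ | 0 < n ∧ m ∣ Nat.fib n}) ⟨k, hk, h⟩

theorem dvd_fib_fibZ_of_ne_zero {m : ℕ} (h : fibZ m ≠ 0) : m ∣ Nat.fib (fibZ m) :=
  (Nat.sInf_mem (Nat.nonempty_of_pos_sInf (Nat.pos_of_ne_zero h))).2

theorem fibZ_dvd_of_dvd_fib {m k : ℕ} (hk : 0 < k) (h : m ∣ Nat.fib k) : fibZ m ∣ k := by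
  obtain ⟨hpos, hdvd⟩ := fibZ_pos_and_dvd hk h
  have hgcd : m ∣ Nat.fib (Nat.gcd (fibZ m) k) := by
    rw [Nat.fib_gcd]
    exact Nat.dvd_gcd hdvd h
  have hle : fibZ m ≤ Nat.gcd (fibZ m) k := Nat.sInf_le ⟨Nat.gcd_pos_of_pos_left _ hpos, hgcd⟩
  have heq := le_antisymm (Nat.le_of_dvd hpos (Nat.gcd_dvd_left _ _)) hle
  exact heq ▸ Nat.gcd_dvd_right _ _

theorem Nat.Prime.fibZ_pos {p : ℕ} (hp : p.Prime) : 0 < fibZ p := by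
  by_cases h5 : p = 5
  · subst h5
    exact (fibZ_pos_and_dvd (k := 5) (by norm_num) (by decide)).1
  · refine (fibZ_pos_and_dvd ?_ (hp.dvd_fib_sq_sub_one h5)).1
    have := hp.two_le
    have : 2 ^ 2 ≤ p ^ 2 := Nat.pow_le_pow_left this 2
    omega

theorem Nat.Prime.coprime_fibZ {p : ℕ} (hp : p.Prime) (h5 : p ≠ 5) : Nat.Coprime p (fibZ p) := by
  have h4 : 2 ^ 2 ≤ p ^ 2 := Nat.pow_le_pow_left hp.two_le 2
  have hdvd : fibZ p ∣ p ^ 2 - 1 := fibZ_dvd_of_dvd_fib (by omega) (hp.dvd_fib_sq_sub_one h5)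
  rw [hp.coprime_iff_not_dvd]
  intro h
  have h1 : p ∣ p ^ 2 - (p ^ 2 - 1) := Nat.dvd_sub (dvd_pow_self p two_ne_zero) (h.trans hdvd)
  rw [Nat.sub_sub_self (by omega)] at h1
  exact hp.one_lt.ne' (Nat.dvd_one.mp h1)

theorem Nat.Prime.mul_lcm_fibZ_le {p m : ℕ} (hp : p.Prime) (hm : m ≠ 0)
    (h : fibZ (p * m) ≠ 0) : p * Nat.lcm m (fibZ p) ≤ 5 * fibL (p * m) := by
  have hz : fibZ p ∣ fibZ (p * m) := fibZ_dvd_of_dvd_fib (Nat.pos_of_ne_zero h)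
    ((dvd_mul_right p m).trans (dvd_fib_fibZ_of_ne_zero h))
  have hpos : 0 < fibL (p * m) :=
    Nat.lcm_pos (Nat.mul_pos hp.pos (Nat.pos_of_ne_zero hm)) (Nat.pos_of_ne_zero h)
  have hlcm : Nat.lcm (p * m) (fibZ p) ∣ fibL (p * m) :=
    Nat.lcm_dvd (Nat.dvd_lcm_left _ _) (hz.trans (Nat.dvd_lcm_right _ _))
  by_cases h5 : p = 5
  · subst h5
    exact Nat.mul_le_mul_left 5 (Nat.le_of_dvd hpos
      ((Nat.lcm_dvd_lcm_of_dvd_left _ (dvd_mul_left m 5)).trans hlcm))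
  · have heq : p * Nat.lcm m (fibZ p) = Nat.lcm (p * m) (fibZ p) := by
      rw [Nat.lcm, Nat.lcm, (hp.coprime_fibZ h5).gcd_mul_left_cancel, mul_assoc,
        Nat.mul_div_assoc _ ((Nat.gcd_dvd_left _ _).mul_right _)]
    rw [heq]
    exact (Nat.le_of_dvd hpos hlcm).trans (Nat.le_mul_of_pos_left _ (by norm_num))

theorem Nat.fib_le_two_pow (n : ℕ) : Nat.fib n ≤ 2 ^ n := by
  have h : Nat.fib n ≤ 2 ^ n ∧ Nat.fib (n + 1) ≤ 2 ^ (n + 1) := by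
    induction n with
    | zero => simp
    | succ n ih =>
      refine ⟨ih.2, ?_⟩
      rw [Nat.fib_add_two, pow_succ, pow_succ]
      rw [pow_succ] at ih
      omega
  exact h.1

/-- At most `k` primes have rank of appearance `k`. -/
theorem card_le_of_forall_fibZ_eq {k : ℕ} (T : Finset Nat.Primes)
    (hT : ∀ p ∈ T, fibZ p = k) : T.card ≤ k := by
  rcases T.eq_empty_or_nonempty with rfl | ⟨q, hq⟩
  · simp
  have hk : 0 < k := hT q hq ▸ q.2.fibZ_pos
  have hdvd : ∏ p ∈ T, (p : ℕ) ∣ Nat.fib k := by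
    refine Finset.prod_dvd_of_isRelPrime ?_ ?_
    · intro a _ b _ hab
      exact Nat.coprime_iff_isRelPrime.mp
        ((Nat.coprime_primes a.2 b.2).mpr fun h => hab (Subtype.ext h))
    · intro p hp
      have := hT p hp
      rw [← this]
      exact dvd_fib_fibZ_of_ne_zero p.2.fibZ_pos.ne'
  have h1 : 2 ^ T.card ≤ ∏ p ∈ T, (p : ℕ) := by
    rw [← Finset.prod_const]
    exact Finset.prod_le_prod' fun p _ => p.2.two_le
  exact (Nat.pow_le_pow_iff_right (by norm_num)).mp
    (h1.trans ((Nat.le_of_dvd (Nat.fib_pos.mpr hk) hdvd).trans (Nat.fib_le_two_pow k)))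

theorem Nat.card_divisors_le_two_mul_sqrt (n : ℕ) : n.divisors.card ≤ 2 * Nat.sqrt n := by
  have hsub : n.divisors ⊆ Finset.Icc 1 (Nat.sqrt n) ∪
      (Finset.Icc 1 (Nat.sqrt n)).image (n / ·) := by
    intro d hd
    obtain ⟨⟨e, rfl⟩, hn⟩ := Nat.mem_divisors.mp hd
    have hd0 : 0 < d := Nat.pos_of_ne_zero (left_ne_zero_of_mul hn)
    have he0 : 0 < e := Nat.pos_of_ne_zero (right_ne_zero_of_mul hn)
    rw [Finset.mem_union, Finset.mem_image]
    rcases le_total d e with h | h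
    · exact Or.inl (Finset.mem_Icc.mpr ⟨hd0, Nat.le_sqrt.mpr (Nat.mul_le_mul_left d h)⟩)
    · exact Or.inr ⟨e, Finset.mem_Icc.mpr ⟨he0, Nat.le_sqrt.mpr (Nat.mul_le_mul_right e h)⟩,
        Nat.mul_div_cancel _ he0⟩
  calc n.divisors.card ≤ _ := Finset.card_le_card hsub
    _ ≤ _ := Finset.card_union_le _ _
    _ ≤ Nat.sqrt n + Nat.sqrt n := by
      gcongr
      · simp
      · exact Finset.card_image_le.trans (by simp)
    _ = 2 * Nat.sqrt n := by ring

open Nat in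
theorem Nat.pow_dvd_factorial_mul {p : ℕ} (hp : p ≠ 0) (k : ℕ) : p ^ k ∣ (p * k)! := by
  induction k with
  | zero => simp
  | succ k ih =>
    rw [pow_succ, mul_add_one]
    exact (mul_dvd_mul ih (Nat.dvd_factorial (Nat.pos_of_ne_zero hp) le_rfl)).trans
      (Nat.factorial_mul_factorial_dvd_factorial_add _ _)

open Nat in
theorem Nat.prod_primesLE_pow_div_dvd_factorial (n : ℕ) :
    ∏ p ∈ Nat.primesLE n, p ^ (n / p) ∣ n ! := by
  refine Finset.prod_dvd_of_isRelPrime ?_ ?_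
  · intro a ha b hb hab
    have ha' := Nat.prime_of_mem_primesLE ha
    have hb' := Nat.prime_of_mem_primesLE hb
    exact (Nat.coprime_iff_isRelPrime.mp ((Nat.coprime_primes ha' hb').mpr hab)).pow
  · intro p hp
    have hp' := Nat.prime_of_mem_primesLE hp
    calc p ^ (n / p) ∣ (p * (n / p))! := Nat.pow_dvd_factorial_mul hp'.ne_zero _
      _ ∣ n ! := Nat.factorial_dvd_factorial (Nat.mul_div_le n p)

/-- An upper bound of Mertens type. -/
theorem sum_primesLE_log_div_le {n : ℕ} (hn : n ≠ 0) :
    ∑ p ∈ Nat.primesLE n, Real.log p / p ≤ Real.log n + Real.log 4 := by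
  have hn' : (0 : ℝ) < n := by exact_mod_cast Nat.pos_of_ne_zero hn
  have h1 : ∑ p ∈ Nat.primesLE n, ((n / p : ℕ) : ℝ) * Real.log p ≤ n * Real.log n := by
    have hle : ((∏ p ∈ Nat.primesLE n, p ^ (n / p) : ℕ) : ℝ) ≤ (n : ℝ) ^ n := by
      exact_mod_cast (Nat.le_of_dvd (Nat.factorial_pos n)
        (Nat.prod_primesLE_pow_div_dvd_factorial n)).trans (Nat.factorial_le_pow n)
    have hpos : (0 : ℝ) < ((∏ p ∈ Nat.primesLE n, p ^ (n / p) : ℕ) : ℝ) := by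
      exact_mod_cast Finset.prod_pos fun p hp => pow_pos (Nat.prime_of_mem_primesLE hp).pos _
    have := Real.log_le_log hpos hle
    rw [Real.log_pow] at this
    refine le_trans (le_of_eq ?_) this
    push_cast
    rw [Real.log_prod]
    · simp only [Real.log_pow]
    · intro p hp
      exact pow_ne_zero _ (Nat.cast_ne_zero.mpr (Nat.prime_of_mem_primesLE hp).ne_zero)
  have h2 : ∑ p ∈ Nat.primesLE n, Real.log p ≤ Real.log 4 * n := by
    rw [← Chebyshev.theta_eq_sum_primesLE_log]
    exact Chebyshev.theta_le_log4_mul_x hn'.le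
  have h3 : n * ∑ p ∈ Nat.primesLE n, Real.log p / p ≤
      ∑ p ∈ Nat.primesLE n, ((n / p : ℕ) : ℝ) * Real.log p + ∑ p ∈ Nat.primesLE n, Real.log p := by
    rw [Finset.mul_sum, ← Finset.sum_add_distrib]
    refine Finset.sum_le_sum fun p hp => ?_
    have hdiv : (n : ℝ) / p ≤ ((n / p : ℕ) : ℝ) + 1 := by
      rw [← Nat.floor_div_eq_div (K := ℝ)]
      exact (Nat.lt_floor_add_one _).le
    calc (n : ℝ) * (Real.log p / p) = n / p * Real.log p := by ring
      _ ≤ (((n / p : ℕ) : ℝ) + 1) * Real.log p := by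
        gcongr
      _ = _ := by ring
  refine le_of_mul_le_mul_left ?_ hn'
  linarith

theorem exists_prod_primesBelow_le_rpow {δ : ℝ} (hδ : 0 < δ) :
    ∃ C : ℝ, 0 < C ∧ ∀ n : ℕ, n ≠ 0 →
      ∏ p ∈ (n + 1).primesBelow, (1 - (p : ℝ)⁻¹)⁻¹ ≤ C * (n : ℝ) ^ δ := by
  obtain ⟨Q, hQ⟩ := exists_nat_ge (Real.exp (2 / δ))
  refine ⟨Real.exp (2 * Q + δ * Real.log 4), Real.exp_pos _, fun n hn => ?_⟩
  have hn' : (0 : ℝ) < n := by exact_mod_cast Nat.pos_of_ne_zero hn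
  have hterm : ∀ p ∈ (n + 1).primesBelow, (1 - (p : ℝ)⁻¹)⁻¹ ≤ Real.exp (2 / p) := by
    intro p hp
    have h2 : (2 : ℝ) ≤ p := by exact_mod_cast (Nat.prime_of_mem_primesBelow hp).two_le
    have hp0 : (0 : ℝ) < p := by linarith
    refine le_trans ?_ (Real.add_one_le_exp _)
    rw [inv_le_comm₀ (by rw [sub_pos]; exact inv_lt_one_of_one_lt₀ (by linarith)) (by positivity),
      inv_eq_one_div, inv_eq_one_div, div_le_iff₀ (by positivity)]
    field_simp
    nlinarith
  have hsplit : ∀ p ∈ (n + 1).primesBelow,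
      (2 : ℝ) / p ≤ (if p < Q then 2 else 0) + δ * (Real.log p / p) := by
    intro p hp
    have h2 : (2 : ℝ) ≤ p := by exact_mod_cast (Nat.prime_of_mem_primesBelow hp).two_le
    have hp0 : (0 : ℝ) < p := by linarith
    have hlog : 0 ≤ Real.log p := Real.log_natCast_nonneg p
    split_ifs with h
    · have h1 : (2 : ℝ) / p ≤ 2 := div_le_self (by norm_num) (by linarith)
      have h3 : 0 ≤ δ * (Real.log p / p) := by positivity
      linarith
    · have hQp : Real.exp (2 / δ) ≤ p := hQ.trans (by exact_mod_cast not_lt.mp h)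
      have h1 : 2 / δ ≤ Real.log p := (Real.le_log_iff_exp_le hp0).mpr hQp
      rw [zero_add, ← mul_div_assoc]
      gcongr
      rwa [div_le_iff₀' hδ] at h1
  have hsmall : ∑ p ∈ (n + 1).primesBelow, (if p < Q then (2 : ℝ) else 0) ≤ 2 * Q := by
    rw [← Finset.sum_filter, Finset.sum_const, nsmul_eq_mul, mul_comm]
    gcongr
    calc _ ≤ (Finset.range Q).card := Finset.card_le_card fun p hp =>
          Finset.mem_range.mpr (Finset.mem_filter.mp hp).2
      _ = Q := Finset.card_range Q
  have hmertens : ∑ p ∈ (n + 1).primesBelow, Real.log p / p ≤ Real.log n + Real.log 4 :=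
    sum_primesLE_log_div_le hn
  calc ∏ p ∈ (n + 1).primesBelow, (1 - (p : ℝ)⁻¹)⁻¹
      ≤ ∏ p ∈ (n + 1).primesBelow, Real.exp (2 / p) := by
        refine Finset.prod_le_prod (fun p hp => ?_) hterm
        have h2 : (1 : ℝ) < p := by exact_mod_cast (Nat.prime_of_mem_primesBelow hp).one_lt
        exact inv_nonneg.mpr (sub_nonneg.mpr (inv_le_one_of_one_le₀ h2.le))
    _ = Real.exp (∑ p ∈ (n + 1).primesBelow, 2 / (p : ℝ)) := (Real.exp_sum _ _).symm
    _ ≤ Real.exp (2 * Q + δ * Real.log 4 + Real.log n * δ) := by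
        refine Real.exp_le_exp.mpr ((Finset.sum_le_sum hsplit).trans ?_)
        rw [Finset.sum_add_distrib, ← Finset.mul_sum]
        nlinarith
    _ = Real.exp (2 * Q + δ * Real.log 4) * (n : ℝ) ^ δ := by
        rw [Real.exp_add, Real.rpow_def_of_pos hn']

theorem exists_tsum_smoothNumbers_inv_le_rpow {δ : ℝ} (hδ : 0 < δ) :
    ∃ C : ℝ, 0 < C ∧ ∀ n : ℕ, n ≠ 0 →
      Summable (fun m : (n + 1).smoothNumbers => ((m : ℕ) : ℝ)⁻¹) ∧
      ∑' m : (n + 1).smoothNumbers, ((m : ℕ) : ℝ)⁻¹ ≤ C * (n : ℝ) ^ δ := by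
  obtain ⟨C, hC, h⟩ := exists_prod_primesBelow_le_rpow hδ
  refine ⟨C, hC, fun n hn => ?_⟩
  let f : ℕ →* ℝ :=
    { toFun := fun m => (m : ℝ)⁻¹
      map_one' := by simp
      map_mul' := fun a b => by simp [mul_comm] }
  have hf : ∀ {p : ℕ}, p.Prime → ‖f p‖ < 1 := by
    intro p hp
    have h1 : (1 : ℝ) < p := by exact_mod_cast hp.one_lt
    simpa [f] using inv_lt_one_of_one_lt₀ h1
  have hsum := (EulerProduct.summable_and_hasSum_smoothNumbers_prod_primesBelow_geometric
    hf (n + 1)).2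
  exact ⟨hsum.summable, hsum.tsum_eq.trans_le (h n hn)⟩

theorem summable_fibZ_rpow :
    Summable (fun p : Nat.Primes => (fibZ p : ℝ) ^ (-(13 / 6) : ℝ)) := by
  have hfin : ∀ k : ℕ, Finite {p : Nat.Primes // fibZ p = k} := by
    intro k
    by_contra hinf
    rw [not_finite_iff_infinite] at hinf
    obtain ⟨T, hT⟩ := Infinite.exists_subset_card_eq {p : Nat.Primes // fibZ p = k} (k + 1)
    have := card_le_of_forall_fibZ_eq (T.map (Function.Embedding.subtype _))
      (by intro p hp; simp only [Finset.mem_map] at hp; obtain ⟨q, -, rfl⟩ := hp; exact q.2)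
    rw [Finset.card_map, hT] at this
    omega
  rw [← (Equiv.sigmaFiberEquiv fun p : Nat.Primes => fibZ p).summable_iff]
  refine (summable_sigma_of_nonneg fun x => by simp only [Function.comp]; positivity).mpr
    ⟨fun k => ?_, ?_⟩
  · exact Summable.of_finite
  · have hbase : Summable (fun k : ℕ => (k : ℝ) ^ (-(7 / 6) : ℝ)) :=
      Real.summable_nat_rpow.mpr (by norm_num)
    refine Summable.of_nonneg_of_le (fun k => tsum_nonneg fun x => ?_) (fun k => ?_) hbase
    · simp only [Function.comp]; positivity
    · let _ := Fintype.ofFinite {p : Nat.Primes // fibZ p = k}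
      have hterm : ∀ x : {p : Nat.Primes // fibZ p = k},
          ((fun p : Nat.Primes => (fibZ p : ℝ) ^ (-(13 / 6) : ℝ)) ∘
            (Equiv.sigmaFiberEquiv fun p : Nat.Primes => fibZ p)) ⟨k, x⟩ =
          (k : ℝ) ^ (-(13 / 6) : ℝ) := by
        rintro ⟨p, rfl⟩
        rfl
      have hcard : Fintype.card {p : Nat.Primes // fibZ p = k} ≤ k := by
        have := card_le_of_forall_fibZ_eq
          ((Finset.univ : Finset {p : Nat.Primes // fibZ p = k}).map (Function.Embedding.subtype _))
          (by intro p hp; simp only [Finset.mem_map] at hp; obtain ⟨q, -, rfl⟩ := hp; exact q.2)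
        rwa [Finset.card_map, Finset.card_univ] at this
      rw [tsum_congr hterm, tsum_fintype, Finset.sum_const, Finset.card_univ, nsmul_eq_mul]
      rcases Nat.eq_zero_or_pos k with rfl | hk
      · rw [Nat.le_zero.mp hcard]
        simp only [Nat.cast_zero, zero_mul]
        positivity
      · have hk' : (0 : ℝ) < k := by exact_mod_cast hk
        calc _ ≤ (k : ℝ) ^ (1 : ℝ) * (k : ℝ) ^ (-(13 / 6) : ℝ) := by
              rw [Real.rpow_one]
              gcongr
          _ = _ := by rw [← Real.rpow_add hk']; norm_num

theorem rpow_mul_rpow_le_add {x z : ℝ} (hx : 0 < x) (hz : 0 < z) :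
    x ^ (-(5 / 6) : ℝ) * z ^ (-(1 / 2) : ℝ) ≤ x ^ (-(13 / 12) : ℝ) + z ^ (-(13 / 6) : ℝ) := by
  rcases le_total (x ^ (1 / 2 : ℝ)) z with h | h
  · have h1 : z ^ (-(1 / 2) : ℝ) ≤ x ^ (-(1 / 4) : ℝ) := by
      refine (Real.rpow_le_rpow_of_nonpos (by positivity) h (by norm_num)).trans_eq ?_
      rw [← Real.rpow_mul hx.le]; norm_num
    calc _ ≤ x ^ (-(5 / 6) : ℝ) * x ^ (-(1 / 4) : ℝ) := by gcongr
      _ = x ^ (-(13 / 12) : ℝ) := by rw [← Real.rpow_add hx]; norm_num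
      _ ≤ _ := le_add_of_nonneg_right (by positivity)
  · have h1 : x ^ (-(5 / 6) : ℝ) ≤ z ^ (-(5 / 3) : ℝ) := by
      refine le_trans (le_of_eq ?_) (Real.rpow_le_rpow_of_nonpos hz h
        (z := -(5 / 3)) (by norm_num))
      rw [← Real.rpow_mul hx.le]; norm_num
    calc _ ≤ z ^ (-(5 / 3) : ℝ) * z ^ (-(1 / 2) : ℝ) := by gcongr
      _ = z ^ (-(13 / 6) : ℝ) := by rw [← Real.rpow_add hz]; norm_num
      _ ≤ _ := le_add_of_nonneg_left (by positivity)

theorem summable_primes_rpow_mul_fibZ_rpow :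
    Summable (fun p : Nat.Primes =>
      ((p : ℕ) : ℝ) ^ (-(5 / 6) : ℝ) * (fibZ p : ℝ) ^ (-(1 / 2) : ℝ)) := by
  have h1 : Summable (fun p : Nat.Primes => ((p : ℕ) : ℝ) ^ (-(13 / 12) : ℝ)) :=
    Nat.Primes.summable_rpow.mpr (by norm_num)
  refine Summable.of_nonneg_of_le (fun p => by positivity) (fun p => ?_)
    (h1.add summable_fibZ_rpow)
  exact rpow_mul_rpow_le_add (by exact_mod_cast p.2.pos) (by exact_mod_cast p.2.fibZ_pos)

/-- Triples `(p, d, m)` with `p` prime, `d ∣ z(p)` and `m` free of prime factors above `p`. -/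
abbrev FibTriple : Type :=
  Σ p : Nat.Primes, (fibZ p).divisors × ((p : ℕ) + 1).smoothNumbers

theorem summable_fibTriple :
    Summable (fun i : FibTriple =>
      5 / (((i.1 : ℕ) : ℝ) * (fibZ i.1 : ℝ)) * (((i.2.2 : ℕ) : ℝ)⁻¹)) := by
  obtain ⟨C, hC, hS⟩ := exists_tsum_smoothNumbers_inv_le_rpow (δ := 1 / 6) (by norm_num)
  have hprod : ∀ p : Nat.Primes,
      HasSum (fun x : (fibZ p).divisors × ((p : ℕ) + 1).smoothNumbers => ((x.2 : ℕ) : ℝ)⁻¹)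
        ((fibZ p).divisors.card * ∑' m : ((p : ℕ) + 1).smoothNumbers, ((m : ℕ) : ℝ)⁻¹) := by
    intro p
    have hs := (hS p p.2.ne_zero).1
    have h1 : HasSum (fun _ : (fibZ p).divisors => (1 : ℝ)) (fibZ p).divisors.card := by
      simpa using hasSum_fintype (fun _ : (fibZ p).divisors => (1 : ℝ))
    have hsum := h1.summable.mul_of_nonneg hs (fun _ => zero_le_one) (fun _ => by positivity)
    simpa using h1.mul hs.hasSum hsum
  refine (summable_sigma_of_nonneg fun i => by positivity).mpr ⟨fun p => ?_, ?_⟩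
  · exact ((hprod p).mul_left (5 / (((p : ℕ) : ℝ) * (fibZ p : ℝ)))).summable
  · refine Summable.of_nonneg_of_le (fun p => tsum_nonneg fun x => by positivity) (fun p => ?_)
      (summable_primes_rpow_mul_fibZ_rpow.mul_left (10 * C))
    have hp : (0 : ℝ) < ((p : ℕ) : ℝ) := by exact_mod_cast p.2.pos
    have hz : (0 : ℝ) < (fibZ p : ℝ) := by exact_mod_cast p.2.fibZ_pos
    have hdiv : ((fibZ p).divisors.card : ℝ) ≤ 2 * (fibZ p : ℝ) ^ (1 / 2 : ℝ) := by
      rw [← Real.sqrt_eq_rpow]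
      calc ((fibZ p).divisors.card : ℝ) ≤ ((2 * Nat.sqrt (fibZ p) : ℕ) : ℝ) := by
            exact_mod_cast Nat.card_divisors_le_two_mul_sqrt _
        _ ≤ _ := by
            push_cast
            gcongr
            exact Real.nat_sqrt_le_real_sqrt
    refine ((hprod p).mul_left (5 / (((p : ℕ) : ℝ) * (fibZ p : ℝ)))).tsum_eq.trans_le ?_
    calc _ ≤ 5 / (((p : ℕ) : ℝ) * (fibZ p : ℝ)) *
          (2 * (fibZ p : ℝ) ^ (1 / 2 : ℝ) * (C * ((p : ℕ) : ℝ) ^ (1 / 6 : ℝ))) := by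
          gcongr
          exact (hS p p.2.ne_zero).2
      _ = 10 * C * ((((p : ℕ) : ℝ) ^ (1 / 6 : ℝ) / ((p : ℕ) : ℝ)) *
          ((fibZ p : ℝ) ^ (1 / 2 : ℝ) / (fibZ p : ℝ))) := by
          field_simp
          norm_num
      _ = _ := by
          rw [← Real.rpow_sub_one hp.ne', ← Real.rpow_sub_one hz.ne']
          norm_num

theorem exists_fibTriple {n : ℕ} (hn : 2 ≤ n) : ∃ i : FibTriple,
    (i.1 : ℕ) * i.2.1 * i.2.2 = n ∧
      1 / (fibL n : ℝ) ≤ 5 / (((i.1 : ℕ) : ℝ) * (fibZ i.1 : ℝ)) * (((i.2.2 : ℕ) : ℝ)⁻¹) := by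
  have hne : n.primeFactors.Nonempty := Nat.nonempty_primeFactors.mpr (by omega)
  obtain ⟨hp, hpn, hn0⟩ := Nat.mem_primeFactors.mp (n.primeFactors.max'_mem hne)
  have hmax : ∀ q, q.Prime → q ∣ n → q ≤ n.primeFactors.max' hne := fun q hq hqn =>
    Finset.le_max' _ _ (Nat.mem_primeFactors.mpr ⟨hq, hqn, hn0⟩)
  generalize n.primeFactors.max' hne = p at hp hpn hmax
  obtain ⟨m, rfl⟩ := hpn
  have hm0 : m ≠ 0 := right_ne_zero_of_mul hn0
  have hz := hp.fibZ_pos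
  have hgm : m.gcd (fibZ p) ∣ m := Nat.gcd_dvd_left _ _
  have hk0 : 0 < m / m.gcd (fibZ p) :=
    Nat.div_pos (Nat.le_of_dvd (Nat.pos_of_ne_zero hm0) hgm) (Nat.gcd_pos_of_pos_right _ hz)
  refine ⟨⟨⟨p, hp⟩, ⟨m.gcd (fibZ p), Nat.mem_divisors.mpr ⟨Nat.gcd_dvd_right _ _, hz.ne'⟩⟩,
    ⟨m / m.gcd (fibZ p), ?_⟩⟩, ?_, ?_⟩
  · refine Nat.mem_smoothNumbers'.mpr fun q hq hqm => Nat.lt_succ_of_le (hmax q hq ?_)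
    exact hqm.trans ((Nat.div_dvd_of_dvd hgm).trans (dvd_mul_left m p))
  · change p * m.gcd (fibZ p) * (m / m.gcd (fibZ p)) = p * m
    rw [mul_assoc, Nat.mul_div_cancel' hgm]
  · change 1 / (fibL (p * m) : ℝ) ≤
      5 / ((p : ℝ) * (fibZ p : ℝ)) * ((m / m.gcd (fibZ p) : ℕ) : ℝ)⁻¹
    by_cases h : fibZ (p * m) = 0
    · rw [fibL, h, Nat.lcm_zero_right, Nat.cast_zero, div_zero]
      positivity
    · have hle := hp.mul_lcm_fibZ_le hm0 h
      have hlcm : m.lcm (fibZ p) = fibZ p * (m / m.gcd (fibZ p)) := by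
        rw [Nat.lcm, mul_comm m, Nat.mul_div_assoc _ hgm]
      rw [hlcm] at hle
      have hle' : (p : ℝ) * ((fibZ p : ℝ) * ((m / m.gcd (fibZ p) : ℕ) : ℝ)) ≤
          5 * (fibL (p * m) : ℝ) := by exact_mod_cast hle
      have hp' : (0 : ℝ) < p := by exact_mod_cast hp.pos
      have hz' : (0 : ℝ) < fibZ p := by exact_mod_cast hz
      have hk' : (0 : ℝ) < ((m / m.gcd (fibZ p) : ℕ) : ℝ) := by exact_mod_cast hk0
      have hL : (0 : ℝ) < fibL (p * m) := by
        have : 0 < (p : ℝ) * ((fibZ p : ℝ) * ((m / m.gcd (fibZ p) : ℕ) : ℝ)) := by positivity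
        linarith
      rw [← div_eq_mul_inv, div_div, div_le_div_iff₀ hL (by positivity)]
      linarith

theorem summable_one_div_fibL :
    Summable (fun n : ℕ => (1 : ℝ) / (fibL (n + 1) : ℝ)) := by
  rw [← summable_nat_add_iff 1]
  choose φ hφ hle using fun n : ℕ => exists_fibTriple (n := n + 1 + 1) (by omega)
  have hinj : Function.Injective φ := by
    intro a b hab
    have h := hφ a
    rw [hab, hφ b] at h
    omega
  exact Summable.of_nonneg_of_le (fun n => by positivity) hle
    (summable_fibTriple.comp_injective hinj)
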